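/- Let d ∈ ℕ, let M be an integer, let ε ∈ (0, 1/2], and let σ ∈ ℝ^d be random with i.i.d. coordinates uniformly distributed on [0, 2^M]. Then for all x, y ∈ ℝ^d with 0 < ‖x−y‖₁ ≤ 2^M, the expected ε-snowflaked quadtree distance satisfies E_σ[T'_σ(x,y)] ≤ (12/ε)·‖x−y‖₁^{1−ε}. -/

import Mathlib

open MeasureTheory
open scoped Classical

/-- The uniform probability measure on the interval `[0, t]`. -/
noncomputable def unif (t : ℝ) : Measure ℝ :=
  (ENNReal.ofReal t)⁻¹ • volume.restrict (Set.Icc 0 t)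

/-- `x` and `y` are separated at level `ℓ` under the shift `σ`: some coordinate of their
grid cells of side `2^ℓ` (after shifting by `σ`) differs. -/
def Separated (d : ℕ) (σ : Fin d → ℝ) (ℓ : ℤ) (x y : Fin d → ℝ) : Prop :=
  ∃ i, ⌊(x i + σ i) / (2 : ℝ) ^ ℓ⌋ ≠ ⌊(y i + σ i) / (2 : ℝ) ^ ℓ⌋

/-- The ε-snowflaked quadtree distance
`T'_σ(x,y) = 2 ⬝ Σ_{ℓ ≤ M} 2^{ℓ(1−ε)} ⬝ 1[x, y separated at level ℓ]`. -/
noncomputable def quadDistSnow (d : ℕ) (M : ℤ) (ε : ℝ) (σ x y : Fin d → ℝ) : ℝ :=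
  2 * ∑' ℓ : ℤ, if ℓ ≤ M ∧ Separated d σ ℓ x y then (2 : ℝ) ^ ((ℓ : ℝ) * (1 - ε)) else 0

/-- The lower Lebesgue integral dominates the Bochner integral of a nonnegative function, with no
measurability assumption. -/
lemma integral_le_of_lintegral_ofReal_le {α : Type*} [MeasurableSpace α] {μ : Measure α}
    {f : α → ℝ} (hf : ∀ a, 0 ≤ f a) {C : ℝ} (hC : 0 ≤ C)
    (h : ∫⁻ a, ENNReal.ofReal (f a) ∂μ ≤ ENNReal.ofReal C) : ∫ a, f a ∂μ ≤ C := by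
  by_cases hi : Integrable f μ
  · rw [integral_eq_lintegral_of_nonneg_ae (Filter.Eventually.of_forall hf)
      hi.aestronglyMeasurable]
    exact ENNReal.toReal_le_of_le_ofReal hC h
  · rwa [integral_undef hi]

lemma ENNReal.ofReal_tsum_le {ι : Type*} {f : ι → ℝ} (hf : ∀ i, 0 ≤ f i) :
    ENNReal.ofReal (∑' i, f i) ≤ ∑' i, ENNReal.ofReal (f i) := by
  by_cases hs : Summable f
  · exact (ENNReal.ofReal_tsum_of_nonneg hf hs).le
  · simp [tsum_eq_zero_of_not_summable hs]

lemma isProbabilityMeasure_unif {t : ℝ} (ht : 0 < t) : IsProbabilityMeasure (unif t) := by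
  constructor
  simp only [unif, Measure.smul_apply, Measure.restrict_apply MeasurableSet.univ, Set.univ_inter,
    Real.volume_Icc, sub_zero, smul_eq_mul]
  exact ENNReal.inv_mul_cancel (by simpa using ht) ENNReal.ofReal_ne_top

lemma measurableSet_floor_ne (a b w : ℝ) :
    MeasurableSet {s : ℝ | ⌊(a + s) / w⌋ ≠ ⌊(b + s) / w⌋} := by
  refine (measurableSet_eq_fun ?_ ?_).compl
  · exact Int.measurable_floor.comp (by fun_prop)
  · exact Int.measurable_floor.comp (by fun_prop)

lemma intervalIntegral_fract_div_add {w : ℝ} (hw : w ≠ 0) (N : ℕ) (a b : ℝ) :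
    ∫ s in (0 : ℝ)..N * w, Int.fract ((a + s) / w) =
      ∫ s in (0 : ℝ)..N * w, Int.fract ((b + s) / w) := by
  have hp : Function.Periodic (fun s : ℝ => Int.fract (s / w)) w := fun s => by
    simp [add_div, div_self hw]
  have := (hp.nat_mul N).intervalIntegral_add_eq a b
  rw [intervalIntegral.integral_comp_add_left (fun s => Int.fract (s / w)) a,
    intervalIntegral.integral_comp_add_left (fun s => Int.fract (s / w)) b]
  simpa using this

lemma intervalIntegrable_fract_div_add (a w u v : ℝ) :
    IntervalIntegrable (fun s : ℝ => Int.fract ((a + s) / w)) volume u v := by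
  rw [intervalIntegrable_iff]
  refine Measure.integrableOn_of_bounded (M := 1) (by simp [Set.uIoc]) ?_ ?_
  · exact (measurable_fract.comp (by fun_prop)).aestronglyMeasurable
  · refine Filter.Eventually.of_forall fun s => ?_
    rw [Real.norm_of_nonneg (Int.fract_nonneg _)]
    exact (Int.fract_lt_one _).le

lemma unif_floor_ne_le_of_le {w : ℝ} (hw : 0 < w) {N : ℕ} (hN : 0 < N) {a b : ℝ} (hab : a ≤ b) :
    unif (N * w) {s : ℝ | ⌊(a + s) / w⌋ ≠ ⌊(b + s) / w⌋} ≤ ENNReal.ofReal ((b - a) / w) := by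
  have hN' : (0 : ℝ) < N := by exact_mod_cast hN
  have ht : 0 < N * w := by positivity
  set F : ℝ → ℝ := fun s =>
    (b - a) / w - (Int.fract ((b + s) / w) - Int.fract ((a + s) / w)) with hF
  have hFfl : ∀ s, F s = ((⌊(b + s) / w⌋ - ⌊(a + s) / w⌋ : ℤ) : ℝ) := fun s => by
    simp only [hF, Int.fract]
    push_cast
    ring
  have hmono : ∀ s, ⌊(a + s) / w⌋ ≤ ⌊(b + s) / w⌋ := fun s => by
    gcongr
  have hF0 : ∀ s, 0 ≤ F s := fun s => by
    rw [hFfl]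
    exact_mod_cast sub_nonneg.2 (hmono s)
  have hia := intervalIntegrable_fract_div_add a w 0 (N * w)
  have hib := intervalIntegrable_fract_div_add b w 0 (N * w)
  have hFi : IntervalIntegrable F volume 0 (N * w) :=
    intervalIntegrable_const.sub (hib.sub hia)
  have hint : ∫ s in (0 : ℝ)..N * w, F s = N * w * ((b - a) / w) := by
    simp only [hF]
    rw [intervalIntegral.integral_sub intervalIntegrable_const (hib.sub hia),
      intervalIntegral.integral_sub hib hia,
      intervalIntegral_fract_div_add hw.ne' N b a, sub_self, sub_zero,
      intervalIntegral.integral_const, sub_zero, smul_eq_mul]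
  have hvol : volume.restrict (Set.Icc 0 (N * w)) {s : ℝ | ⌊(a + s) / w⌋ ≠ ⌊(b + s) / w⌋} ≤
      ENNReal.ofReal (N * w * ((b - a) / w)) := by
    rw [← hint, intervalIntegral.integral_of_le ht.le, ← integral_Icc_eq_integral_Ioc,
      ofReal_integral_eq_lintegral_ofReal
        ((intervalIntegrable_iff_integrableOn_Icc_of_le ht.le).1 hFi)
        (Filter.Eventually.of_forall hF0),
      ← lintegral_indicator_one (measurableSet_floor_ne a b w)]
    refine lintegral_mono fun s => Set.indicator_apply_le' (fun hs => ?_) fun _ => zero_le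
    rw [Pi.one_apply, ENNReal.one_le_ofReal, hFfl]
    have h1 : ⌊(a + s) / w⌋ < ⌊(b + s) / w⌋ := lt_of_le_of_ne (hmono s) hs
    exact_mod_cast (by lia : (1 : ℤ) ≤ ⌊(b + s) / w⌋ - ⌊(a + s) / w⌋)
  rw [unif, Measure.smul_apply, smul_eq_mul]
  calc _ ≤ (ENNReal.ofReal (N * w))⁻¹ * ENNReal.ofReal (N * w * ((b - a) / w)) := by gcongr
    _ = ENNReal.ofReal ((b - a) / w) := by
      rw [ENNReal.ofReal_mul ht.le, ← mul_assoc,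
        ENNReal.inv_mul_cancel (ENNReal.ofReal_pos.2 ht).ne' ENNReal.ofReal_ne_top, one_mul]

lemma unif_floor_ne_le {w : ℝ} (hw : 0 < w) {N : ℕ} (hN : 0 < N) (a b : ℝ) :
    unif (N * w) {s : ℝ | ⌊(a + s) / w⌋ ≠ ⌊(b + s) / w⌋} ≤ ENNReal.ofReal (|a - b| / w) := by
  rcases le_total a b with h | h
  · rw [abs_sub_comm, abs_of_nonneg (sub_nonneg.2 h)]
    exact unif_floor_ne_le_of_le hw hN h
  · rw [abs_of_nonneg (sub_nonneg.2 h)]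
    simpa only [ne_comm] using unif_floor_ne_le_of_le hw hN h

lemma measurableSet_separated {d : ℕ} (ℓ : ℤ) (x y : Fin d → ℝ) :
    MeasurableSet {σ | Separated d σ ℓ x y} := by
  simp only [Separated, Set.ofPred_exists]
  exact MeasurableSet.iUnion fun i =>
    (measurableSet_floor_ne (x i) (y i) ((2 : ℝ) ^ ℓ)).preimage (measurable_pi_apply i)

lemma pi_unif_separated_le {d : ℕ} {M ℓ : ℤ} (hℓ : ℓ ≤ M) (x y : Fin d → ℝ) :
    (Measure.pi fun _ : Fin d => unif ((2 : ℝ) ^ M)) {σ | Separated d σ ℓ x y} ≤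
      ENNReal.ofReal ((∑ i, |x i - y i|) / (2 : ℝ) ^ ℓ) := by
  have := isProbabilityMeasure_unif (t := (2 : ℝ) ^ M) (by positivity)
  have hM : (2 : ℝ) ^ M = ((2 ^ (M - ℓ).toNat : ℕ) : ℝ) * 2 ^ ℓ := by
    push_cast
    rw [← zpow_natCast, ← zpow_add₀ two_ne_zero]
    congr 1
    lia
  simp only [Separated, Set.ofPred_exists]
  refine (measure_iUnion_fintype_le _ _).trans ?_
  rw [Finset.sum_div, ENNReal.ofReal_sum_of_nonneg fun i _ => by positivity]
  refine Finset.sum_le_sum fun i _ => ?_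
  have h := (measurePreserving_eval (fun _ : Fin d => unif ((2 : ℝ) ^ M)) i).measure_preimage
    (measurableSet_floor_ne (x i) (y i) ((2 : ℝ) ^ ℓ)).nullMeasurableSet
  refine h.le.trans ?_
  rw [hM]
  exact unif_floor_ne_le (by positivity) (by positivity) _ _

lemma hasSum_two_rpow_neg_pow {p : ℝ} (hp : 0 < p) :
    HasSum (fun n : ℕ => (2 : ℝ) ^ (-(n : ℝ) * p)) (1 - (2 : ℝ) ^ (-p))⁻¹ := by
  have h := hasSum_geometric_of_lt_one (r := (2 : ℝ) ^ (-p)) (by positivity)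
    (Real.rpow_lt_one_of_one_lt_of_neg one_lt_two (by linarith))
  convert h using 2 with n
  rw [← Real.rpow_natCast, ← Real.rpow_mul zero_le_two]
  ring_nf

lemma inv_one_sub_two_rpow_neg_le {p : ℝ} (hp : 0 < p) (hp1 : p ≤ 1) :
    (1 - (2 : ℝ) ^ (-p))⁻¹ ≤ 2 / p := by
  have h := rpow_one_add_le_one_add_mul_self (s := -1 / 2) (by norm_num) hp.le hp1
  have h2 : (2 : ℝ) ^ (-p) = (1 + -1 / 2) ^ p := by
    rw [Real.rpow_neg zero_le_two, ← Real.inv_rpow zero_le_two]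
    norm_num
  rw [h2, ← inv_div p 2]
  exact inv_anti₀ (by positivity : 0 < p / 2) (by linarith)

/-- The series `∑ ℓ, 2 ^ (ℓ (1 - ε)) * min 1 (D / 2 ^ ℓ)`, cut at the level of `D`. -/
lemma exists_hasSum_levels {ε D : ℝ} (h0 : 0 < ε) (h1 : ε ≤ 1 / 2) (hD : 0 < D) :
    ∃ (k : ℤ) (S : ℝ), HasSum (fun ℓ : ℤ => if ℓ ≤ k then (2 : ℝ) ^ ((ℓ : ℝ) * (1 - ε))
      else D * (2 : ℝ) ^ (-(ℓ : ℝ) * ε)) S ∧ S ≤ 4 / ε * D ^ (1 - ε) := by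
  obtain ⟨k, hk, hk'⟩ := exists_mem_Ico_zpow hD one_lt_two
  have hlow : (2 : ℝ) ^ ((k : ℝ) * (1 - ε)) ≤ D ^ (1 - ε) := by
    rw [Real.rpow_mul zero_le_two, Real.rpow_intCast]
    exact Real.rpow_le_rpow (by positivity) hk (by linarith)
  have hhigh : D * (2 : ℝ) ^ (-((k : ℝ) + 1) * ε) ≤ D ^ (1 - ε) := by
    have e : (2 : ℝ) ^ (-((k : ℝ) + 1) * ε) = ((2 : ℝ) ^ (k + 1)) ^ (-ε) := by
      rw [← Real.rpow_intCast, ← Real.rpow_mul zero_le_two]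
      push_cast
      ring_nf
    rw [e, sub_eq_add_neg, Real.rpow_add hD, Real.rpow_one]
    exact mul_le_mul_of_nonneg_left
      (Real.rpow_le_rpow_of_nonpos hD hk'.le (by linarith)) hD.le
  have ha := (hasSum_two_rpow_neg_pow h0).mul_left (D * (2 : ℝ) ^ (-((k : ℝ) + 1) * ε))
  have hb := (hasSum_two_rpow_neg_pow (p := 1 - ε) (by linarith)).mul_left
    ((2 : ℝ) ^ ((k : ℝ) * (1 - ε)))
  refine ⟨k, _, (Equiv.addLeft (k + 1)).hasSum_iff.1 (HasSum.of_nat_of_neg_add_one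
    (ha.congr_fun ?_) (hb.congr_fun ?_)), ?_⟩
  · intro n
    have : ¬ (k + 1 + (n : ℤ) ≤ k) := by lia
    rw [Function.comp_apply, Equiv.coe_addLeft, if_neg this]
    rw [mul_assoc, ← Real.rpow_add two_pos]
    push_cast
    ring_nf
  · intro n
    have : k + 1 + -((n : ℤ) + 1) ≤ k := by lia
    rw [Function.comp_apply, Equiv.coe_addLeft, if_pos this]
    rw [← Real.rpow_add two_pos]
    push_cast
    ring_nf
  · have i1 := inv_one_sub_two_rpow_neg_le h0 (by linarith)
    have i2 := inv_one_sub_two_rpow_neg_le (p := 1 - ε) (by linarith) (by linarith)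
    have i3 : 2 / (1 - ε) ≤ 2 / ε := by gcongr; linarith
    calc _ ≤ D ^ (1 - ε) * (2 / ε) + D ^ (1 - ε) * (2 / ε) := by
          gcongr ?_ + ?_
          · exact (mul_le_mul_of_nonneg_left i1 (by positivity)).trans
              (mul_le_mul_of_nonneg_right hhigh (by positivity))
          · exact (mul_le_mul_of_nonneg_left (i2.trans i3) (by positivity)).trans
              (mul_le_mul_of_nonneg_right hlow (by positivity))
      _ = 4 / ε * D ^ (1 - ε) := by ring

/-- For any integer `M`, `ε ∈ (0, 1/2]`, and `σ ∈ ℝ^d` with i.i.d. coordinates uniform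
on `[0, 2^M]`: for all `x, y ∈ ℝ^d` with `0 < ‖x−y‖₁ ≤ 2^M`, the expected ε-snowflaked
quadtree distance satisfies `E_σ[T'_σ(x,y)] ≤ (12/ε)·‖x−y‖₁^{1−ε}`. -/
theorem stmt14 (d : ℕ) (M : ℤ) (ε : ℝ) (hε : ε ∈ Set.Ioc (0 : ℝ) (1 / 2))
    (x y : Fin d → ℝ)
    (h0 : 0 < ∑ i, |x i - y i|) (h1 : ∑ i, |x i - y i| ≤ (2 : ℝ) ^ M) :
    ∫ σ, quadDistSnow d M ε σ x y ∂(Measure.pi fun _ : Fin d => unif ((2 : ℝ) ^ M)) ≤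
      (12 / ε) * (∑ i, |x i - y i|) ^ (1 - ε) := by
  obtain ⟨hε0, hε1⟩ := hε
  have := isProbabilityMeasure_unif (t := (2 : ℝ) ^ M) (by positivity)
  set μ := Measure.pi fun _ : Fin d => unif ((2 : ℝ) ^ M) with hμ
  set D := ∑ i, |x i - y i| with hD
  obtain ⟨k, S, hS, hSle⟩ := exists_hasSum_levels hε0 hε1 h0
  have hterm : ∀ (ℓ : ℤ) (σ : Fin d → ℝ), 0 ≤ if ℓ ≤ M ∧ Separated d σ ℓ x y then
      (2 : ℝ) ^ ((ℓ : ℝ) * (1 - ε)) else 0 := fun ℓ σ => by positivity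
  have hmeas : ∀ ℓ : ℤ, MeasurableSet {σ | ℓ ≤ M ∧ Separated d σ ℓ x y} := fun ℓ =>
    (MeasurableSet.const _).inter (measurableSet_separated ℓ x y)
  have hlevel : ∀ ℓ : ℤ, ∫⁻ σ, ENNReal.ofReal (if ℓ ≤ M ∧ Separated d σ ℓ x y then
      (2 : ℝ) ^ ((ℓ : ℝ) * (1 - ε)) else 0) ∂μ ≤ ENNReal.ofReal (if ℓ ≤ k then
        (2 : ℝ) ^ ((ℓ : ℝ) * (1 - ε)) else D * (2 : ℝ) ^ (-(ℓ : ℝ) * ε)) := by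
    intro ℓ
    have e : ∀ σ, ENNReal.ofReal (if ℓ ≤ M ∧ Separated d σ ℓ x y then
        (2 : ℝ) ^ ((ℓ : ℝ) * (1 - ε)) else 0) = {σ | ℓ ≤ M ∧ Separated d σ ℓ x y}.indicator
          (fun _ => ENNReal.ofReal ((2 : ℝ) ^ ((ℓ : ℝ) * (1 - ε)))) σ := fun σ => by
      simp only [Set.indicator_apply, Set.mem_ofPred_eq]
      split_ifs <;> simp
    simp only [e]
    rw [lintegral_indicator_const (hmeas ℓ)]
    split_ifs with hk
    · exact mul_le_of_le_one_right' prob_le_one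
    · by_cases hℓ : ℓ ≤ M
      · simp only [hℓ, true_and]
        refine (mul_le_mul_right (pi_unif_separated_le hℓ x y) _).trans_eq ?_
        rw [← ENNReal.ofReal_mul (by positivity), ← hD, mul_div_left_comm,
          ← Real.rpow_intCast, ← Real.rpow_sub two_pos]
        ring_nf
      · simp [hℓ]
  refine integral_le_of_lintegral_ofReal_le
    (fun σ => mul_nonneg zero_le_two (tsum_nonneg fun ℓ => hterm ℓ σ)) (by positivity) ?_
  calc ∫⁻ σ, ENNReal.ofReal (quadDistSnow d M ε σ x y) ∂μ
      ≤ ∫⁻ σ, 2 * ∑' ℓ : ℤ, ENNReal.ofReal (if ℓ ≤ M ∧ Separated d σ ℓ x y then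
          (2 : ℝ) ^ ((ℓ : ℝ) * (1 - ε)) else 0) ∂μ := by
        refine lintegral_mono fun σ => ?_
        rw [quadDistSnow, ENNReal.ofReal_mul zero_le_two, ENNReal.ofReal_ofNat]
        gcongr
        exact ENNReal.ofReal_tsum_le fun ℓ => hterm ℓ σ
    _ = 2 * ∑' ℓ : ℤ, ∫⁻ σ, ENNReal.ofReal (if ℓ ≤ M ∧ Separated d σ ℓ x y then
          (2 : ℝ) ^ ((ℓ : ℝ) * (1 - ε)) else 0) ∂μ := by
        rw [lintegral_const_mul' _ _ ENNReal.ofNat_ne_top, lintegral_tsum fun ℓ => ?_]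
        exact (Measurable.ite (hmeas ℓ) measurable_const
          measurable_const).ennreal_ofReal.aemeasurable
    _ ≤ 2 * ENNReal.ofReal S := by
        gcongr
        rw [← hS.tsum_eq, ENNReal.ofReal_tsum_of_nonneg (fun ℓ => by positivity) hS.summable]
        exact ENNReal.tsum_le_tsum hlevel
    _ ≤ ENNReal.ofReal (12 / ε * D ^ (1 - ε)) := by
        rw [← ENNReal.ofReal_ofNat 2, ← ENNReal.ofReal_mul zero_le_two]
        refine ENNReal.ofReal_le_ofReal ?_
        have : 2 * (4 / ε * D ^ (1 - ε)) ≤ 12 / ε * D ^ (1 - ε) := by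
          rw [← mul_assoc, ← mul_div_assoc]
          gcongr
          norm_num
        linarith
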